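/- Let k ≥ 1 be a constant integer and suppose K_n → ∞, K_n²/P_n → 0, and p_{e,q}(n) = (ln n + (k−1)·ln ln n + b·ln ln n + β_n)/n, where b is a constant integer and the real sequence β_n satisfies −1 < liminf_{n→∞} β_n/ln ln n ≤ limsup_{n→∞} β_n/ln ln n < 1. If k + b ≤ 0, then the probability that the minimum degree δ_n of 𝔾_q(n,K_n,P_n,p_n) equals 0 converges to 1 as n → ∞. -/

import Mathlib

open Finset Filter

/-- A configuration of the random graph `𝔾_q(n,K,P,p)`: a key-ring assignment
(one finite subset of the key pool `Fin P` per vertex) together with the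
on/off states of the channels (one Boolean per unordered pair of vertices). -/
abbrev Config (n P : ℕ) : Type := (Fin n → Finset (Fin P)) × (Sym2 (Fin n) → Bool)

/-- Probability weight of a configuration: the key rings are independent and
uniform over the `K`-element subsets of the pool of size `P`, and the channels
are independent Bernoulli(`p`). -/
noncomputable def weight (n K P : ℕ) (p : ℝ) (ω : Config n P) : ℝ :=
  (∏ i : Fin n, if (ω.1 i).card = K then ((P.choose K : ℝ))⁻¹ else 0) *
  (∏ e : Sym2 (Fin n), if ω.2 e then p else 1 - p)

/-- Probability of an event in `𝔾_q(n,K,P,p)`. -/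
noncomputable def prob (n K P : ℕ) (p : ℝ) (E : Set (Config n P)) : ℝ :=
  ∑ ω : Config n P, Set.indicator E (weight n K P p) ω

/-- Adjacency in `𝔾_q(n,K,P,p)`: two distinct vertices are adjacent iff their
key rings share at least `q` keys and the channel between them is on. -/
def Adj (q n P : ℕ) (ω : Config n P) (i j : Fin n) : Prop :=
  i ≠ j ∧ q ≤ ((ω.1 i) ∩ (ω.1 j)).card ∧ ω.2 s(i, j) = true

/-- Degree of a vertex. -/
noncomputable def degree (q n P : ℕ) (ω : Config n P) (i : Fin n) : ℕ :=
  Nat.card {j : Fin n // Adj q n P ω i j}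

/-- Minimum degree of the graph. -/
noncomputable def minDeg (q n P : ℕ) (ω : Config n P) : ℕ :=
  sInf (Set.range fun i => degree q n P ω i)

/-- `p_{s,q}`: the probability that two key rings share at least `q` keys. -/
noncomputable def psq (q K P : ℕ) : ℝ :=
  1 - ∑ u ∈ Finset.range q,
    ((K.choose u : ℝ) * ((P - K).choose (K - u) : ℝ)) / (P.choose K : ℝ)

/-- `p_{e,q}`: the probability that two distinct vertices are adjacent. -/
noncomputable def peq (q K P : ℕ) (p : ℝ) : ℝ := p * psq q K P


/-- The weight of a single key ring under the uniform law on the `K`-element subsets of the pool. -/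
noncomputable def ringWeight (K P : ℕ) (U : Finset (Fin P)) : ℝ :=
  if U.card = K then ((P.choose K : ℝ))⁻¹ else 0

/-- The factor `1 - p` if the two key rings share at least `q` keys, and `1` otherwise: the
conditional probability, given the rings, that the corresponding vertices are not adjacent. -/
noncomputable def nonadjFactor (q P : ℕ) (p : ℝ) (T U : Finset (Fin P)) : ℝ :=
  if q ≤ (T ∩ U).card then 1 - p else 1

section FiniteSums

variable {ι X : Type*} [Fintype ι] [DecidableEq ι] [Fintype X] [DecidableEq X]

lemma sum_prod_pinned_one (i : ι) (w : X → ℝ) (φ : X → X → ℝ) :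
    ∑ S : ι → X, ∏ j, (w (S j) * if j = i then 1 else φ (S i) (S j)) =
      ∑ T, w T * (∑ U, w U * φ T U) ^ (Fintype.card ι - 1) := by
  have h1 : ∀ T, w T * (∑ U, w U * φ T U) ^ (Fintype.card ι - 1) =
      ∏ j : ι, ∑ U, (w U * if j = i then (if U = T then 1 else 0) else φ T U) := by
    intro T
    rw [← Finset.mul_prod_erase Finset.univ _ (Finset.mem_univ i)]
    congr 1
    · simp
    · rw [Finset.prod_congr rfl (g := fun _ => ∑ U, w U * φ T U)]
      · simp
      · intro j hj
        simp [Finset.ne_of_mem_erase hj]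
  simp_rw [h1, Finset.prod_univ_sum, Fintype.piFinset_univ]
  rw [Finset.sum_comm]
  refine Finset.sum_congr rfl fun S _ => ?_
  rw [Finset.sum_eq_single (S i)]
  · refine Finset.prod_congr rfl fun j _ => ?_
    by_cases h : j = i
    · subst h; simp
    · simp [h]
  · intro T _ hT
    refine Finset.prod_eq_zero (Finset.mem_univ i) ?_
    simp [Ne.symm hT]
  · simp

lemma sum_prod_pinned_two {i i' : ι} (hii : i ≠ i') (w : X → ℝ) (ψ : X → X → X → ℝ) :
    ∑ S : ι → X, ∏ j, (w (S j) * if j = i ∨ j = i' then 1 else ψ (S i) (S i') (S j)) =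
      ∑ T, ∑ T', w T * w T' * (∑ U, w U * ψ T T' U) ^ (Fintype.card ι - 2) := by
  have h1 : ∀ T T', w T * w T' * (∑ U, w U * ψ T T' U) ^ (Fintype.card ι - 2) =
      ∏ j : ι, ∑ U, (w U * if j = i then (if U = T then 1 else 0) else
        if j = i' then (if U = T' then 1 else 0) else ψ T T' U) := by
    intro T T'
    rw [← Finset.mul_prod_erase Finset.univ _ (Finset.mem_univ i),
      ← Finset.mul_prod_erase (Finset.univ.erase i) _
        (Finset.mem_erase.2 ⟨hii.symm, Finset.mem_univ i'⟩), mul_assoc]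
    congr 1
    · simp
    congr 1
    · simp [hii.symm]
    · rw [Finset.prod_congr rfl (g := fun _ => ∑ U, w U * ψ T T' U)]
      · rw [Finset.prod_const, Finset.card_erase_of_mem (by simp [hii.symm]),
          Finset.card_erase_of_mem (Finset.mem_univ i), Finset.card_univ, Nat.sub_sub]
      · intro j hj
        simp only [Finset.mem_erase] at hj
        simp [hj.1, hj.2.1]
  simp_rw [h1, Finset.prod_univ_sum, Fintype.piFinset_univ]
  simp_rw [Finset.sum_comm (s := (Finset.univ : Finset X)) (t := (Finset.univ : Finset (ι → X)))]
  refine Finset.sum_congr rfl fun S _ => ?_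
  rw [Finset.sum_eq_single (S i), Finset.sum_eq_single (S i')]
  · refine Finset.prod_congr rfl fun j _ => ?_
    by_cases h : j = i
    · subst h; simp
    · by_cases h' : j = i'
      · subst h'; simp [h]
      · simp [h, h']
  · intro T _ hT
    refine Finset.prod_eq_zero (Finset.mem_univ i') ?_
    simp [Ne.symm hT, hii.symm]
  · simp
  · intro T _ hT
    refine Finset.sum_eq_zero fun T' _ => Finset.prod_eq_zero (Finset.mem_univ i) ?_
    simp [Ne.symm hT]
  · simp

lemma sum_channels_off (p : ℝ) (B : Finset ι) :
    ∑ c : ι → Bool, (∏ e, if c e then p else 1 - p) *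
      (if ∀ e ∈ B, c e = false then 1 else 0) = (1 - p) ^ B.card := by
  have h1 : ∀ c : ι → Bool, (∏ e, if c e then p else 1 - p) *
      (if ∀ e ∈ B, c e = false then (1 : ℝ) else 0) =
      ∏ e, ((if c e then p else 1 - p) * if e ∈ B ∧ c e = true then 0 else 1) := by
    intro c
    rw [Finset.prod_mul_distrib]
    congr 1
    split_ifs with h
    · refine (Finset.prod_eq_one fun e _ => ?_).symm
      rw [if_neg]
      rintro ⟨he, hc⟩
      simp [h e he] at hc
    · push Not at h
      obtain ⟨e, he, hc⟩ := h
      refine (Finset.prod_eq_zero (Finset.mem_univ e) ?_).symm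
      simp [he, hc]
  simp_rw [h1]
  have h2 := (Finset.prod_univ_sum (fun _ : ι => (Finset.univ : Finset Bool))
    (fun e b => (if b then p else 1 - p) * if e ∈ B ∧ b = true then (0 : ℝ) else 1)).symm
  rw [Fintype.piFinset_univ] at h2
  rw [h2]
  have h3 : ∀ e, (∑ b : Bool, (if b then p else 1 - p) *
      if e ∈ B ∧ b = true then (0 : ℝ) else 1) = if e ∈ B then 1 - p else 1 := by
    intro e
    by_cases h : e ∈ B <;> simp [h]
  simp_rw [h3]
  rw [Finset.prod_ite_mem, Finset.univ_inter, Finset.prod_const]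

/-- The second moment method for a finite family of events with `0`-`1` indicators `Z i`. -/
lemma second_moment_bound {Ω : Type*} [Fintype Ω] (W : Ω → ℝ) (hW : ∀ ω, 0 ≤ W ω)
    (hW1 : ∑ ω, W ω = 1) (Z : ι → Ω → ℝ) (hZ : ∀ i ω, Z i ω * Z i ω = Z i ω)
    (a b : ℝ) (ha : 0 < a) (hι : 2 ≤ Fintype.card ι)
    (h1 : ∀ i, ∑ ω, W ω * Z i ω = a)
    (h2 : ∀ i j, i ≠ j → ∑ ω, W ω * (Z i ω * Z j ω) ≤ b)
    (D : Ω → ℝ) (hD : ∀ ω, D ω ≤ 1) (hD' : ∀ ω, (∃ i, Z i ω ≠ 0) → D ω ≤ 0) :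
    ∑ ω, W ω * D ω ≤ 1 / (Fintype.card ι * a) + b / a ^ 2 - 1 := by
  obtain ⟨N, hN⟩ : ∃ N : ℝ, N = Fintype.card ι := ⟨_, rfl⟩
  rw [← hN]
  have hN0 : 0 < N := by rw [hN]; exact_mod_cast (by lia : 0 < Fintype.card ι)
  have hb : 0 ≤ b := by
    obtain ⟨i, j, hij⟩ := Fintype.one_lt_card_iff.1 hι
    have hz : ∀ i ω, 0 ≤ Z i ω := fun i ω => by rw [← hZ i ω]; exact mul_self_nonneg _
    exact (Finset.sum_nonneg fun ω _ =>
      mul_nonneg (hW ω) (mul_nonneg (hz i ω) (hz j ω))).trans (h2 i j hij)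
  have hEX : ∑ ω, W ω * ∑ i, Z i ω = N * a := by
    simp_rw [Finset.mul_sum]
    rw [Finset.sum_comm]
    simp [h1, hN]
  have hEX2 : ∑ ω, W ω * (∑ i, Z i ω) ^ 2 ≤ N * a + N * (N - 1) * b := by
    have : ∀ ω, W ω * (∑ i, Z i ω) ^ 2 = ∑ i, ∑ j, W ω * (Z i ω * Z j ω) := by
      intro ω
      rw [pow_two, Finset.sum_mul_sum, Finset.mul_sum]
      simp_rw [Finset.mul_sum]
    simp_rw [this]
    rw [Finset.sum_comm]
    simp_rw [Finset.sum_comm (s := (Finset.univ : Finset Ω))]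
    have hrow : ∀ i, ∑ j, ∑ ω, W ω * (Z i ω * Z j ω) ≤ a + (N - 1) * b := by
      intro i
      rw [← Finset.add_sum_erase Finset.univ _ (Finset.mem_univ i)]
      refine add_le_add (by simp_rw [hZ, h1]; rfl) ?_
      refine (Finset.sum_le_card_nsmul _ _ b fun j hj => h2 i j
        (Finset.ne_of_mem_erase hj).symm).trans ?_
      rw [nsmul_eq_mul, Finset.card_erase_of_mem (Finset.mem_univ i), Finset.card_univ,
        Nat.cast_sub (by lia), Nat.cast_one, hN]
    refine (Finset.sum_le_card_nsmul _ _ _ fun i _ => hrow i).trans ?_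
    rw [nsmul_eq_mul, Finset.card_univ, ← hN]
    apply le_of_eq; ring
  have hcheb : ∑ ω, W ω * (D ω * (N * a) ^ 2) ≤ ∑ ω, W ω * (∑ i, Z i ω - N * a) ^ 2 := by
    refine Finset.sum_le_sum fun ω _ => mul_le_mul_of_nonneg_left ?_ (hW ω)
    by_cases h : ∃ i, Z i ω ≠ 0
    · nlinarith [hD' ω h, sq_nonneg (∑ i, Z i ω - N * a), sq_nonneg (N * a)]
    · push Not at h
      simp only [h, Finset.sum_const_zero, zero_sub, neg_sq]
      nlinarith [hD ω, sq_nonneg (N * a)]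
  have hexp : ∑ ω, W ω * (∑ i, Z i ω - N * a) ^ 2 =
      ∑ ω, W ω * (∑ i, Z i ω) ^ 2 - (N * a) ^ 2 := by
    have : ∀ ω, W ω * (∑ i, Z i ω - N * a) ^ 2 = W ω * (∑ i, Z i ω) ^ 2 -
        2 * (N * a) * (W ω * ∑ i, Z i ω) + (N * a) ^ 2 * W ω := fun ω => by ring
    simp_rw [this, Finset.sum_add_distrib, Finset.sum_sub_distrib, ← Finset.mul_sum, hEX, hW1]
    ring
  simp_rw [← mul_assoc, ← Finset.sum_mul] at hcheb
  have hle : (∑ ω, W ω * D ω) * (N * a) ^ 2 ≤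
      (1 / (N * a) + b / a ^ 2 - 1) * (N * a) ^ 2 := by
    have : (1 / (N * a) + b / a ^ 2 - 1) * (N * a) ^ 2 = N * a + N ^ 2 * b - (N * a) ^ 2 := by
      field_simp
    rw [this]
    nlinarith [mul_nonneg hN0.le hb]
  exact le_of_mul_le_mul_right hle (by positivity)

end FiniteSums

/-- The channels that must be off for vertex `i` to be isolated, given the key rings `S`. -/
def starChannels (q n P : ℕ) (S : Fin n → Finset (Fin P)) (i : Fin n) : Finset (Sym2 (Fin n)) :=
  (Finset.univ.filter fun j => j ≠ i ∧ q ≤ (S i ∩ S j).card).image fun j => s(i, j)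

lemma degree_eq_zero_iff (q n P : ℕ) (ω : Config n P) (i : Fin n) :
    degree q n P ω i = 0 ↔ ∀ e ∈ starChannels q n P ω.1 i, ω.2 e = false := by
  rw [degree, Finite.card_eq_zero_iff, isEmpty_subtype]
  simp only [starChannels, Finset.forall_mem_image, Finset.mem_filter, Finset.mem_univ, true_and]
  refine forall_congr' fun j => ?_
  simp only [Adj, ne_comm (a := i)]
  rw [← Bool.not_eq_true]
  tauto

lemma weight_nonneg {n K P : ℕ} {p : ℝ} (hp0 : 0 ≤ p) (hp1 : p ≤ 1) (ω : Config n P) :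
    0 ≤ weight n K P p ω := by
  refine mul_nonneg (Finset.prod_nonneg fun i _ => ?_) (Finset.prod_nonneg fun e _ => ?_)
  · split_ifs <;> positivity
  · split_ifs <;> linarith

lemma ringWeight_nonneg (K P : ℕ) (U : Finset (Fin P)) : 0 ≤ ringWeight K P U := by
  unfold ringWeight
  split_ifs <;> positivity

lemma sum_ringWeight_mul (K P : ℕ) (f : Finset (Fin P) → ℝ) :
    ∑ U, ringWeight K P U * f U =
      (∑ U ∈ Finset.powersetCard K Finset.univ, f U) / P.choose K := by
  simp only [ringWeight, ite_mul, zero_mul]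
  rw [← Finset.sum_filter, Finset.sum_div]
  have : Finset.univ.filter (fun U : Finset (Fin P) => U.card = K) =
      Finset.powersetCard K Finset.univ := by
    ext U; simp [Finset.mem_powersetCard]
  rw [this]
  exact Finset.sum_congr rfl fun U _ => by rw [div_eq_inv_mul]

lemma sum_ringWeight {K P : ℕ} (h : K ≤ P) : ∑ U, ringWeight K P U = 1 := by
  have := sum_ringWeight_mul K P fun _ => 1
  simp only [mul_one] at this
  rw [this]
  have : (P.choose K : ℝ) ≠ 0 := by exact_mod_cast (Nat.choose_pos h).ne'
  simp [this]

lemma sum_weight_channels_off (n K P : ℕ) (p : ℝ)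
    (B : (Fin n → Finset (Fin P)) → Finset (Sym2 (Fin n))) :
    ∑ ω : Config n P, weight n K P p ω * (if ∀ e ∈ B ω.1, ω.2 e = false then 1 else 0) =
      ∑ S : Fin n → Finset (Fin P), (∏ i, ringWeight K P (S i)) * (1 - p) ^ (B S).card := by
  rw [Fintype.sum_prod_type]
  refine Finset.sum_congr rfl fun S _ => ?_
  rw [← sum_channels_off, Finset.mul_sum]
  refine Finset.sum_congr rfl fun c _ => ?_
  rw [weight, mul_assoc]
  rfl

lemma sum_weight {n K P : ℕ} (p : ℝ) (h : K ≤ P) : ∑ ω : Config n P, weight n K P p ω = 1 := by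
  have := sum_weight_channels_off n K P p fun _ => ∅
  simp only [Finset.notMem_empty, false_imp_iff, implies_true, if_true, mul_one,
    Finset.card_empty, pow_zero] at this
  rw [this]
  have h2 := Finset.prod_univ_sum (fun _ : Fin n => (Finset.univ : Finset (Finset (Fin P))))
    (fun _ U => ringWeight K P U)
  rw [Fintype.piFinset_univ] at h2
  rw [← h2]
  simp [sum_ringWeight h]

lemma one_sub_pow_card_starChannels (q n P : ℕ) (p : ℝ) (S : Fin n → Finset (Fin P)) (i : Fin n) :
    (1 - p) ^ (starChannels q n P S i).card =
      ∏ j, if j = i then 1 else nonadjFactor q P p (S i) (S j) := by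
  rw [starChannels, Finset.card_image_of_injective _ fun a b h => Sym2.congr_right.1 h]
  rw [← Finset.prod_const, Finset.prod_filter]
  refine Finset.prod_congr rfl fun j _ => ?_
  by_cases h : j = i <;> simp [h, nonadjFactor]

lemma one_sub_pow_card_union_starChannels_le (q n P : ℕ) {p : ℝ} (hp0 : 0 ≤ p) (hp1 : p ≤ 1)
    (S : Fin n → Finset (Fin P)) {i i' : Fin n} (hii : i ≠ i') :
    (1 - p) ^ (starChannels q n P S i ∪ starChannels q n P S i').card ≤
      ∏ j, if j = i ∨ j = i' then 1 else
        nonadjFactor q P p (S i) (S j) * nonadjFactor q P p (S i') (S j) := by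
  set F : Fin n → Finset (Fin n) := fun a =>
    Finset.univ.filter fun j => (j ≠ i ∧ j ≠ i') ∧ q ≤ (S a ∩ S j).card with hF
  have hcard : (F i).card + (F i').card ≤
      (starChannels q n P S i ∪ starChannels q n P S i').card := by
    have hd : Disjoint ((F i).image fun j => s(i, j)) ((F i').image fun j => s(i', j)) := by
      rw [Finset.disjoint_left]
      simp only [Finset.mem_image, not_exists, not_and, hF, Finset.mem_filter]
      rintro e ⟨j, ⟨-, ⟨hj, hj'⟩, -⟩, rfl⟩ l ⟨-, ⟨hl, hl'⟩, -⟩ h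
      rw [Sym2.eq_iff] at h
      rcases h with h | h
      · exact hii h.1.symm
      · exact hl h.2
    rw [← Finset.card_image_of_injective (F i) fun a b h => (Sym2.congr_right (a := i)).1 h,
      ← Finset.card_image_of_injective (F i') fun a b h => (Sym2.congr_right (a := i')).1 h,
      ← Finset.card_union_of_disjoint hd]
    refine Finset.card_le_card (Finset.union_subset_union ?_ ?_)
    · refine Finset.image_subset_image fun j hj => ?_
      simp only [hF, Finset.mem_filter] at hj ⊢
      exact ⟨hj.1, hj.2.1.1, hj.2.2⟩
    · refine Finset.image_subset_image fun j hj => ?_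
      simp only [hF, Finset.mem_filter] at hj ⊢
      exact ⟨hj.1, hj.2.1.2, hj.2.2⟩
  refine (pow_le_pow_of_le_one (by linarith) (by linarith) hcard).trans (le_of_eq ?_)
  rw [pow_add, ← Finset.prod_const, ← Finset.prod_const, Finset.prod_filter, Finset.prod_filter,
    ← Finset.prod_mul_distrib]
  refine Finset.prod_congr rfl fun j _ => ?_
  by_cases h : j = i
  · simp [h]
  by_cases h' : j = i'
  · simp [h']
  simp [h, h', nonadjFactor]

lemma prob_isolated (q n K P : ℕ) (p : ℝ) (i : Fin n) :
    ∑ ω : Config n P, weight n K P p ω * (if degree q n P ω i = 0 then 1 else 0) =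
      ∑ T, ringWeight K P T *
        (∑ U, ringWeight K P U * nonadjFactor q P p T U) ^ (n - 1) := by
  simp_rw [degree_eq_zero_iff]
  rw [sum_weight_channels_off n K P p fun S => starChannels q n P S i]
  have := sum_prod_pinned_one i (ringWeight K P) (nonadjFactor q P p)
  rw [Fintype.card_fin] at this
  rw [← this]
  refine Finset.sum_congr rfl fun S _ => ?_
  rw [Finset.prod_mul_distrib, one_sub_pow_card_starChannels]

lemma prob_two_isolated_le (q n K P : ℕ) {p : ℝ} (hp0 : 0 ≤ p) (hp1 : p ≤ 1) {i i' : Fin n}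
    (hii : i ≠ i') :
    ∑ ω : Config n P, weight n K P p ω * ((if degree q n P ω i = 0 then 1 else 0) *
      (if degree q n P ω i' = 0 then 1 else 0)) ≤
      ∑ T, ∑ T', ringWeight K P T * ringWeight K P T' *
        (∑ U, ringWeight K P U *
          (nonadjFactor q P p T U * nonadjFactor q P p T' U)) ^ (n - 2) := by
  have hind : ∀ ω : Config n P, ((if degree q n P ω i = 0 then (1 : ℝ) else 0) *
      (if degree q n P ω i' = 0 then 1 else 0)) =
      if ∀ e ∈ starChannels q n P ω.1 i ∪ starChannels q n P ω.1 i', ω.2 e = false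
        then 1 else 0 := by
    intro ω
    simp only [Finset.forall_mem_union, ← degree_eq_zero_iff]
    by_cases h : degree q n P ω i = 0 <;> simp [h]
  simp_rw [hind]
  rw [sum_weight_channels_off n K P p fun S => starChannels q n P S i ∪ starChannels q n P S i']
  have := sum_prod_pinned_two hii (ringWeight K P)
    fun T T' U => nonadjFactor q P p T U * nonadjFactor q P p T' U
  rw [Fintype.card_fin] at this
  rw [← this]
  refine Finset.sum_le_sum fun S _ => ?_
  rw [Finset.prod_mul_distrib]
  exact mul_le_mul_of_nonneg_left (one_sub_pow_card_union_starChannels_le q n P hp0 hp1 S hii)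
    (Finset.prod_nonneg fun i _ => ringWeight_nonneg K P _)

lemma one_sub_prob_minDeg_le (q : ℕ) {n K P : ℕ} {p : ℝ} (hp0 : 0 ≤ p) (hp1 : p ≤ 1)
    (hKP : K ≤ P) (hn : 2 ≤ n) {a b : ℝ} (ha : 0 < a)
    (h1 : ∑ T, ringWeight K P T *
      (∑ U, ringWeight K P U * nonadjFactor q P p T U) ^ (n - 1) = a)
    (h2 : ∑ T, ∑ T', ringWeight K P T * ringWeight K P T' *
      (∑ U, ringWeight K P U *
        (nonadjFactor q P p T U * nonadjFactor q P p T' U)) ^ (n - 2) ≤ b) :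
    1 - prob n K P p {ω | minDeg q n P ω = 0} ≤ 1 / (n * a) + b / a ^ 2 - 1 := by
  have key := second_moment_bound (weight n K P p) (weight_nonneg hp0 hp1) (sum_weight p hKP)
    (fun (i : Fin n) ω => if degree q n P ω i = 0 then 1 else 0) (by simp) a b ha
    (by simpa using hn) (fun i => (prob_isolated q n K P p i).trans h1)
    (fun i j hij => (prob_two_isolated_le q n K P hp0 hp1 hij).trans h2)
    (fun ω => 1 - Set.indicator {ω | minDeg q n P ω = 0} 1 ω)
    (fun ω => sub_le_self _ (Set.indicator_nonneg (fun _ _ => zero_le_one) _))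
    (fun ω ⟨i, hi⟩ => by
      have : minDeg q n P ω = 0 := Nat.sInf_eq_zero.2 (Or.inl ⟨i, by simpa using hi⟩)
      simp [this])
  rw [Fintype.card_fin] at key
  refine le_trans (le_of_eq ?_) key
  simp_rw [mul_sub, mul_one, Finset.sum_sub_distrib, sum_weight p hKP, prob]
  congr 1
  refine Finset.sum_congr rfl fun ω _ => ?_
  by_cases h : minDeg q n P ω = 0 <;> simp [h]

lemma prob_le_one {n K P : ℕ} {p : ℝ} (hp0 : 0 ≤ p) (hp1 : p ≤ 1) (hKP : K ≤ P)
    (E : Set (Config n P)) : prob n K P p E ≤ 1 := by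
  rw [← sum_weight p hKP]
  exact Finset.sum_le_sum fun ω _ => Set.indicator_le_self' (fun _ _ => weight_nonneg hp0 hp1 _) ω

lemma choose_mul_add_pow_le {B J : ℕ} (h : J ≤ B) (m : ℕ) :
    B.choose J * (B + m) ^ m ≤ (J + m) ^ m * (B + m).choose (J + m) := by
  induction m generalizing B J with
  | zero => simp
  | succ m ih =>
    have h1 := ih (Nat.succ_le_succ h)
    have h2 := Nat.add_one_mul_choose_eq B J
    have h3 : (J + 1) * (B + 1 + m) ≤ (B + 1) * (J + 1 + m) := by nlinarith
    rw [show B + (m + 1) = B + 1 + m by ring, show J + (m + 1) = J + 1 + m by ring]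
    simp only [Nat.succ_eq_add_one] at h1
    refine Nat.le_of_mul_le_mul_left ?_ (Nat.succ_pos B)
    calc (B + 1) * (B.choose J * (B + 1 + m) ^ (m + 1))
        = ((B + 1) * B.choose J) * (B + 1 + m) ^ (m + 1) := by ring
      _ = (J + 1) * (B + 1 + m) * ((B + 1).choose (J + 1) * (B + 1 + m) ^ m) := by
        rw [h2]; ring
      _ ≤ (B + 1) * (J + 1 + m) * ((J + 1 + m) ^ m * (B + 1 + m).choose (J + 1 + m)) :=
        Nat.mul_le_mul h3 h1
      _ = (B + 1) * ((J + 1 + m) ^ (m + 1) * (B + 1 + m).choose (J + 1 + m)) := by ring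

lemma choose_add_le (A d m : ℕ) :
    (A + d).choose m * (A + d) ≤ A.choose m * (A + d) + d * m * (A + d).choose m := by
  rcases m with _ | m
  · simp
  have hstep : ∀ d, (A + d).choose (m + 1) ≤ A.choose (m + 1) + d * (A + d - 1).choose m := by
    intro d
    induction d with
    | zero => simp
    | succ d ih =>
      have h1 : (A + (d + 1)).choose (m + 1) = (A + d).choose m + (A + d).choose (m + 1) := by
        rw [← add_assoc, Nat.choose_succ_succ]
      have h2 : (A + d - 1).choose m ≤ (A + d).choose m :=
        Nat.choose_le_choose m (Nat.sub_le _ _)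
      rw [h1, show A + (d + 1) - 1 = A + d by lia]
      nlinarith
  rcases Nat.eq_zero_or_pos (A + d) with h0 | h0
  · simp [h0]
  obtain ⟨B, hB⟩ : ∃ B, A + d = B + 1 := ⟨A + d - 1, by lia⟩
  have h1 := hstep d
  rw [hB] at h1 ⊢
  have h2 := Nat.add_one_mul_choose_eq B m
  simp only [Nat.add_sub_cancel] at h1
  calc (B + 1).choose (m + 1) * (B + 1) ≤ (A.choose (m + 1) + d * B.choose m) * (B + 1) :=
        Nat.mul_le_mul_right _ h1
    _ = A.choose (m + 1) * (B + 1) + d * ((B + 1) * B.choose m) := by ring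
    _ = A.choose (m + 1) * (B + 1) + d * (m + 1) * (B + 1).choose (m + 1) := by rw [h2]; ring

/-- The probability that a random key ring satisfies `Q`. -/
noncomputable def ringProb (K P : ℕ) (Q : Finset (Fin P) → Prop) [DecidablePred Q] : ℝ :=
  ∑ U, ringWeight K P U * if Q U then 1 else 0

lemma ringProb_eq_card (K P : ℕ) (Q : Finset (Fin P) → Prop) [DecidablePred Q] :
    ringProb K P Q = ((Finset.powersetCard K Finset.univ).filter Q).card / P.choose K := by
  rw [ringProb, sum_ringWeight_mul, Finset.sum_boole]

lemma ringProb_mono {K P : ℕ} {Q R : Finset (Fin P) → Prop} [DecidablePred Q] [DecidablePred R]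
    (h : ∀ U, Q U → R U) : ringProb K P Q ≤ ringProb K P R := by
  refine Finset.sum_le_sum fun U _ => mul_le_mul_of_nonneg_left ?_ (ringWeight_nonneg K P U)
  by_cases hq : Q U
  · simp [hq, h U hq]
  · simp only [hq, if_false]; split_ifs <;> norm_num

lemma ringProb_or_le {K P : ℕ} (Q R : Finset (Fin P) → Prop) [DecidablePred Q] [DecidablePred R] :
    ringProb K P (fun U => Q U ∨ R U) ≤ ringProb K P Q + ringProb K P R := by
  rw [ringProb, ringProb, ringProb, ← Finset.sum_add_distrib]
  refine Finset.sum_le_sum fun U _ => ?_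
  rw [← mul_add]
  refine mul_le_mul_of_nonneg_left ?_ (ringWeight_nonneg K P U)
  by_cases hq : Q U <;> by_cases hr : R U <;> simp [hq, hr]

lemma ringProb_subset_le {K P : ℕ} (hKP : K ≤ P) (A : Finset (Fin P)) :
    ringProb K P (fun U => A ⊆ U) ≤ ((K : ℝ) / P) ^ A.card := by
  rw [ringProb_eq_card]
  rcases lt_or_ge K A.card with h | h
  · rw [Finset.filter_eq_empty_iff.2]
    · simp only [Finset.card_empty, Nat.cast_zero, zero_div]; positivity
    · intro U hU hA
      have := Finset.card_le_card hA
      rw [(Finset.mem_powersetCard.1 hU).2] at this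
      lia
  have hcard : ((Finset.powersetCard K Finset.univ).filter fun U => A ⊆ U).card ≤
      (P - A.card).choose (K - A.card) := by
    have : (P - A.card).choose (K - A.card) = (Finset.powersetCard (K - A.card) Aᶜ).card := by
      rw [Finset.card_powersetCard, Finset.card_compl, Fintype.card_fin]
    rw [this]
    refine Finset.card_le_card_of_injOn (fun U => U \ A) ?_ ?_
    · intro U hU
      simp only [Finset.coe_filter, Finset.mem_powersetCard, Set.mem_ofPred_eq] at hU
      refine Finset.mem_powersetCard.2 ⟨fun v hv => ?_, ?_⟩
      · simp only [Finset.mem_sdiff] at hv; simpa using hv.2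
      · rw [Finset.card_sdiff_of_subset hU.2, hU.1.2]
    · intro U hU V hV h
      simp only [Finset.coe_filter, Set.mem_ofPred_eq] at hU hV
      have h' : U \ A = V \ A := h
      rw [← Finset.sdiff_union_of_subset hU.2, ← Finset.sdiff_union_of_subset hV.2, h']
  have hle := choose_mul_add_pow_le (Nat.sub_le_sub_right hKP A.card) A.card
  rw [Nat.sub_add_cancel (h.trans hKP), Nat.sub_add_cancel h] at hle
  have hc : (0 : ℝ) < P.choose K := by exact_mod_cast Nat.choose_pos hKP
  rcases Nat.eq_zero_or_pos P with hP | hP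
  · subst hP
    have hA : A = ∅ := Subsingleton.elim _ _
    subst hA
    have hK : K = 0 := by lia
    subst hK
    simp
  have hP' : (0 : ℝ) < P := by exact_mod_cast hP
  rw [div_pow, div_le_div_iff₀ hc (by positivity)]
  calc (((Finset.powersetCard K Finset.univ).filter fun U => A ⊆ U).card : ℝ) * (P : ℝ) ^ A.card
      ≤ ((P - A.card).choose (K - A.card) : ℕ) * (P : ℝ) ^ A.card := by gcongr
    _ ≤ _ := by exact_mod_cast hle

lemma ringProb_inter_card_ge_le {K P : ℕ} (hKP : K ≤ P) (T : Finset (Fin P)) (m : ℕ) :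
    ringProb K P (fun U => m ≤ (T ∩ U).card) ≤ ((T.card : ℝ) * (K / P)) ^ m := by
  have h1 : ringProb K P (fun U => m ≤ (T ∩ U).card) ≤
      ∑ A ∈ Finset.powersetCard m T, ringProb K P (fun U => A ⊆ U) := by
    simp only [ringProb]
    rw [Finset.sum_comm]
    refine Finset.sum_le_sum fun U _ => ?_
    rw [← Finset.mul_sum]
    refine mul_le_mul_of_nonneg_left ?_ (ringWeight_nonneg K P U)
    split_ifs with h
    · obtain ⟨A, hA, hAm⟩ := Finset.exists_subset_card_eq h
      refine le_trans ?_ (Finset.single_le_sum (fun B _ => ?_) (Finset.mem_powersetCard.2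
        ⟨hA.trans Finset.inter_subset_left, hAm⟩))
      · simp [hA.trans Finset.inter_subset_right]
      · split_ifs <;> norm_num
    · exact Finset.sum_nonneg fun B _ => by split_ifs <;> norm_num
  refine h1.trans ((Finset.sum_le_sum fun A hA => ringProb_subset_le hKP A).trans ?_)
  rw [Finset.sum_congr rfl (g := fun _ => ((K : ℝ) / P) ^ m) fun A hA => by
    rw [(Finset.mem_powersetCard.1 hA).2]]
  rw [Finset.sum_const, Finset.card_powersetCard, nsmul_eq_mul, mul_pow]
  gcongr
  exact_mod_cast Nat.choose_le_pow _ _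

lemma ringProb_inter_card_eq {K P : ℕ} {T : Finset (Fin P)} (hT : T.card = K) (u : ℕ) :
    ringProb K P (fun U => (T ∩ U).card = u) =
      (K.choose u : ℝ) * (P - K).choose (K - u) / P.choose K := by
  rw [ringProb_eq_card]
  congr 1
  rcases lt_or_ge K u with h | h
  · rw [Nat.choose_eq_zero_of_lt h, Finset.filter_eq_empty_iff.2]
    · simp
    · intro U _ hU
      have := Finset.card_le_card (Finset.inter_subset_left (s₁ := T) (s₂ := U))
      lia
  have hprod : (K.choose u * (P - K).choose (K - u)) =
      (Finset.powersetCard u T ×ˢ Finset.powersetCard (K - u) Tᶜ).card := by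
    rw [Finset.card_product, Finset.card_powersetCard, Finset.card_powersetCard,
      Finset.card_compl, Fintype.card_fin, hT]
  rw [← Nat.cast_mul, hprod]
  congr 1
  refine Finset.card_nbij' (fun U => (T ∩ U, U \ T)) (fun A => A.1 ∪ A.2) ?_ ?_ ?_ ?_
  · intro U hU
    simp only [Finset.coe_filter, Finset.mem_powersetCard, Set.mem_ofPred_eq] at hU
    simp only [Finset.mem_coe, Finset.mem_product, Finset.mem_powersetCard]
    refine ⟨⟨Finset.inter_subset_left, hU.2⟩, fun v hv => ?_, ?_⟩
    · simp only [Finset.mem_sdiff] at hv; simpa using hv.2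
    · rw [Finset.card_sdiff, hU.2, hU.1.2]
  · rintro ⟨A, B⟩ hAB
    simp only [Finset.mem_coe, Finset.mem_product, Finset.mem_powersetCard] at hAB
    obtain ⟨⟨hA, hAu⟩, hB, hBu⟩ := hAB
    have hd : Disjoint T B := Finset.disjoint_left.2 fun v hv hvB => by
      have := hB hvB; simp [hv] at this
    simp only [Finset.coe_filter, Finset.mem_powersetCard, Set.mem_ofPred_eq]
    refine ⟨⟨Finset.subset_univ _, ?_⟩, ?_⟩
    · rw [Finset.card_union_of_disjoint (Finset.disjoint_of_subset_left hA hd)]; lia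
    · rw [Finset.inter_union_distrib_left, Finset.disjoint_iff_inter_eq_empty.1 hd,
        Finset.union_empty, Finset.inter_eq_right.2 hA, hAu]
  · intro U _
    ext v; simp only [Finset.mem_union, Finset.mem_inter, Finset.mem_sdiff]; tauto
  · rintro ⟨A, B⟩ hAB
    simp only [Finset.mem_coe, Finset.mem_product, Finset.mem_powersetCard] at hAB
    obtain ⟨⟨hA, hAu⟩, hB, hBu⟩ := hAB
    have hd : ∀ v, v ∈ B → v ∉ T := fun v hv => by simpa using hB hv
    refine Prod.ext ?_ ?_ <;> ext v <;>
      simp only [Finset.mem_union, Finset.mem_inter, Finset.mem_sdiff]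
    · exact ⟨fun h => h.2.resolve_right fun hv => hd v hv h.1, fun h => ⟨hA h, Or.inl h⟩⟩
    · exact ⟨fun h => h.1.resolve_left fun hv => h.2 (hA hv), fun h => ⟨Or.inr h, hd v h⟩⟩

lemma ringProb_share_eq_psq (q : ℕ) {K P : ℕ} (hKP : K ≤ P) {T : Finset (Fin P)}
    (hT : T.card = K) : ringProb K P (fun U => q ≤ (T ∩ U).card) = psq q K P := by
  rw [psq, ← sum_ringWeight hKP]
  simp_rw [← ringProb_inter_card_eq hT]
  rw [eq_sub_iff_add_eq]
  simp only [ringProb]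
  rw [Finset.sum_comm, ← Finset.sum_add_distrib]
  refine Finset.sum_congr rfl fun U _ => ?_
  rw [← Finset.mul_sum, ← mul_add, Finset.sum_ite_eq]
  by_cases h : q ≤ (T ∩ U).card
  · simp [h, not_lt.2 h]
  · simp [h, not_le.1 h]

lemma le_psq {q K P : ℕ} (hq : 1 ≤ q) (hqK : 2 * q ≤ K) (hKP : 4 * K ^ 2 ≤ P) :
    ((K : ℝ) ^ 2 / P) ^ q / (2 * 4 ^ q * (q.factorial : ℝ) ^ 2) ≤ psq q K P := by
  have hKP' : K ≤ P := by nlinarith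
  obtain ⟨T, hT⟩ : ∃ T : Finset (Fin P), T.card = K := by
    obtain ⟨T, -, hT⟩ := Finset.exists_subset_card_eq
      (s := (Finset.univ : Finset (Fin P))) (n := K) (by simpa using hKP')
    exact ⟨T, hT⟩
  rw [← ringProb_share_eq_psq q hKP' hT]
  refine le_trans ?_ (ringProb_mono (Q := fun U => (T ∩ U).card = q) fun U h => h.ge)
  rw [ringProb_inter_card_eq hT]
  have h1 : (P - q).choose (K - q) ≤ 2 * (P - K).choose (K - q) := by
    have := choose_add_le (P - K) (K - q) (K - q)
    rw [show P - K + (K - q) = P - q by lia] at this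
    have h2 : 2 * ((K - q) * (K - q)) ≤ P - q := by
      have : (K - q) * (K - q) ≤ K * K := Nat.mul_le_mul (Nat.sub_le _ _) (Nat.sub_le _ _)
      have : q ≤ P := by lia
      zify [this] at *
      nlinarith
    have h3 := Nat.mul_le_mul_right ((P - q).choose (K - q)) h2
    refine Nat.le_of_mul_le_mul_right (c := P - q) ?_ (by lia)
    nlinarith
  have h2 := Nat.choose_mul (n := P) (k := K) (s := q) (by lia)
  have h3 : (K : ℝ) ^ q ≤ 2 ^ q * (q.factorial * K.choose q) := by
    have h := Nat.pow_sub_le_descFactorial K q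
    rw [Nat.descFactorial_eq_factorial_mul_choose] at h
    have h' : K ^ q ≤ 2 ^ q * (K + 1 - q) ^ q := by
      rw [← mul_pow]; exact Nat.pow_le_pow_left (by lia) q
    exact_mod_cast h'.trans (Nat.mul_le_mul_left _ h)
  have h4 : (P.choose q : ℝ) ≤ (P : ℝ) ^ q := by exact_mod_cast Nat.choose_le_pow P q
  have hc : (0 : ℝ) < P.choose K := by exact_mod_cast Nat.choose_pos hKP'
  have hP : (0 : ℝ) < P := by exact_mod_cast (by nlinarith : 0 < P)
  rw [div_pow, div_div, div_le_div_iff₀ (by positivity) hc]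
  have h1' : ((P - q).choose (K - q) : ℝ) ≤ 2 * (P - K).choose (K - q) := by exact_mod_cast h1
  have h2' : (P.choose K : ℝ) * K.choose q = P.choose q * (P - q).choose (K - q) := by
    exact_mod_cast h2
  have h5 : ((K : ℝ) ^ 2) ^ q ≤ 4 ^ q * q.factorial ^ 2 * (K.choose q : ℝ) ^ 2 := by
    calc ((K : ℝ) ^ 2) ^ q = ((K : ℝ) ^ q) ^ 2 := by ring
      _ ≤ ((2 : ℝ) ^ q * (q.factorial * K.choose q)) ^ 2 := by gcongr
      _ = (4 : ℝ) ^ q * q.factorial ^ 2 * (K.choose q : ℝ) ^ 2 := by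
        rw [show (4 : ℝ) ^ q = (2 ^ q) ^ 2 by rw [← pow_mul, mul_comm, pow_mul]; norm_num]
        ring
  calc ((K : ℝ) ^ 2) ^ q * P.choose K
      ≤ (4 : ℝ) ^ q * q.factorial ^ 2 * (K.choose q : ℝ) ^ 2 * P.choose K := by gcongr
    _ = (4 : ℝ) ^ q * q.factorial ^ 2 * K.choose q * (P.choose K * K.choose q) := by ring
    _ = (4 : ℝ) ^ q * q.factorial ^ 2 * K.choose q * (P.choose q * (P - q).choose (K - q)) := by
      rw [h2']
    _ ≤ (4 : ℝ) ^ q * q.factorial ^ 2 * K.choose q * (P ^ q * (2 * (P - K).choose (K - q))) := by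
      gcongr
    _ = _ := by ring

lemma sum_exp_inter_card_le {K P : ℕ} (hKP : K ≤ P) {T : Finset (Fin P)} (hT : T.card = K)
    {a : ℝ} (ha : 0 ≤ a) :
    ∑ U, ringWeight K P U * Real.exp (a * (T ∩ U).card) ≤
      Real.exp (Real.exp a * ((K : ℝ) ^ 2 / P)) := by
  set y := Real.exp a - 1 with hy
  have hy0 : 0 ≤ y := by linarith [Real.one_le_exp ha]
  have h1 : ∀ U : Finset (Fin P), Real.exp (a * (T ∩ U).card) =
      ∑ A ∈ T.powerset, y ^ A.card * if A ⊆ U then 1 else 0 := by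
    intro U
    rw [mul_comm, Real.exp_nat_mul, show Real.exp a = y + 1 by rw [hy]; ring,
      ← Finset.sum_pow_mul_eq_add_pow]
    simp only [one_pow, mul_one, mul_ite, mul_zero]
    rw [← Finset.sum_filter]
    refine Finset.sum_congr ?_ fun _ _ => rfl
    ext A
    rw [Finset.mem_filter, Finset.mem_powerset, Finset.mem_powerset, Finset.subset_inter_iff]
  simp_rw [h1, Finset.mul_sum]
  rw [Finset.sum_comm]
  calc ∑ A ∈ T.powerset, ∑ U, ringWeight K P U * (y ^ A.card * if A ⊆ U then 1 else 0)
      = ∑ A ∈ T.powerset, y ^ A.card * ringProb K P (fun U => A ⊆ U) := by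
        refine Finset.sum_congr rfl fun A _ => ?_
        rw [ringProb, Finset.mul_sum]
        exact Finset.sum_congr rfl fun U _ => by ring
    _ ≤ ∑ A ∈ T.powerset, (y * (K / P)) ^ A.card * 1 ^ (T.card - A.card) := by
        refine Finset.sum_le_sum fun A _ => ?_
        rw [one_pow, mul_one, mul_pow]
        exact mul_le_mul_of_nonneg_left (ringProb_subset_le hKP A) (by positivity)
    _ = (y * (K / P) + 1) ^ K := by rw [Finset.sum_pow_mul_eq_add_pow, hT]
    _ ≤ Real.exp (y * (K / P)) ^ K := by
        gcongr
        exact Real.add_one_le_exp _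
    _ = Real.exp (K * (y * (K / P))) := by rw [← Real.exp_nat_mul]
    _ ≤ _ := by
        refine Real.exp_le_exp.2 ?_
        rw [show (K : ℝ) * (y * (K / P)) = y * ((K : ℝ) ^ 2 / P) by ring]
        gcongr
        linarith

lemma nonadjFactor_eq (q P : ℕ) (p : ℝ) (T U : Finset (Fin P)) :
    nonadjFactor q P p T U = 1 - p * if q ≤ (T ∩ U).card then 1 else 0 := by
  rw [nonadjFactor]; split_ifs <;> ring

lemma sum_nonadjFactor (q : ℕ) {K P : ℕ} (p : ℝ) (hKP : K ≤ P) {T : Finset (Fin P)}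
    (hT : T.card = K) :
    ∑ U, ringWeight K P U * nonadjFactor q P p T U = 1 - peq q K P p := by
  simp_rw [nonadjFactor_eq, mul_sub, mul_one, Finset.sum_sub_distrib, sum_ringWeight hKP, peq,
    ← ringProb_share_eq_psq q hKP hT, ringProb, Finset.mul_sum]
  congr 1
  exact Finset.sum_congr rfl fun U _ => by ring

lemma ringProb_share_both_le {q K P : ℕ} (hq : 1 ≤ q) (hK : 1 ≤ K) (hKP : K ≤ P)
    {T T' : Finset (Fin P)} (hT : T.card = K) (hT' : T'.card = K) :
    ringProb K P (fun U => q ≤ (T ∩ U).card ∧ q ≤ (T' ∩ U).card) ≤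
      ((K : ℝ) ^ 2 / P) ^ q / K * (T ∩ T').card + (2 * ((K : ℝ) ^ 2 / P)) ^ (q + 1) := by
  have h1 := ringProb_mono (K := K) (P := P)
    (Q := fun U => q ≤ (T ∩ U).card ∧ q ≤ (T' ∩ U).card)
    (R := fun U => q ≤ ((T ∩ T') ∩ U).card ∨ q + 1 ≤ ((T ∪ T') ∩ U).card) fun U hU => by
      have h := Finset.card_union_add_card_inter (T ∩ U) (T' ∩ U)
      rw [← Finset.union_inter_distrib_right, ← Finset.inter_inter_distrib_right] at h
      lia
  refine h1.trans ((ringProb_or_le _ _).trans (add_le_add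
    ((ringProb_inter_card_ge_le hKP _ _).trans ?_) ((ringProb_inter_card_ge_le hKP _ _).trans ?_)))
  · have hK0 : (0 : ℝ) < K := by exact_mod_cast hK
    have hu : ((T ∩ T').card : ℝ) / K ≤ 1 := by
      rw [div_le_one hK0, ← hT]
      exact_mod_cast Finset.card_le_card Finset.inter_subset_left
    have hu' : (((T ∩ T').card : ℝ) / K) ^ q ≤ (T ∩ T').card / K :=
      pow_le_of_le_one (by positivity) hu (by lia)
    calc (((T ∩ T').card : ℝ) * (K / P)) ^ q
        = (((T ∩ T').card : ℝ) / K) ^ q * ((K : ℝ) ^ 2 / P) ^ q := by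
          rw [← mul_pow]; congr 1; field_simp
      _ ≤ (T ∩ T').card / K * ((K : ℝ) ^ 2 / P) ^ q := by gcongr
      _ = _ := by ring
  · have : ((T ∪ T').card : ℝ) ≤ 2 * K := by
      have := Finset.card_union_le T T'
      exact_mod_cast (by lia : (T ∪ T').card ≤ 2 * K)
    calc (((T ∪ T').card : ℝ) * (K / P)) ^ (q + 1) ≤ (2 * K * (K / P)) ^ (q + 1) := by gcongr
      _ = _ := by congr 1; ring

lemma sum_nonadjFactor_mul (q : ℕ) {K P : ℕ} (p : ℝ) (hKP : K ≤ P)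
    {T T' : Finset (Fin P)} (hT : T.card = K) (hT' : T'.card = K) :
    ∑ U, ringWeight K P U * (nonadjFactor q P p T U * nonadjFactor q P p T' U) =
      1 - 2 * peq q K P p +
        p ^ 2 * ringProb K P (fun U => q ≤ (T ∩ U).card ∧ q ≤ (T' ∩ U).card) := by
  have h : ∀ U, ringWeight K P U * (nonadjFactor q P p T U * nonadjFactor q P p T' U) =
      ringWeight K P U * nonadjFactor q P p T U + ringWeight K P U * nonadjFactor q P p T' U
        - ringWeight K P U + p ^ 2 * (ringWeight K P U *
          if q ≤ (T ∩ U).card ∧ q ≤ (T' ∩ U).card then 1 else 0) := by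
    intro U
    simp only [nonadjFactor_eq]
    by_cases h1 : q ≤ (T ∩ U).card <;> by_cases h2 : q ≤ (T' ∩ U).card <;>
      simp only [h1, h2, and_self, and_true, and_false, if_true, if_false] <;> ring
  simp_rw [h, Finset.sum_add_distrib, Finset.sum_sub_distrib, Finset.sum_add_distrib,
    ← Finset.mul_sum, sum_nonadjFactor q p hKP hT, sum_nonadjFactor q p hKP hT',
    sum_ringWeight hKP]
  rw [ringProb]; ring

lemma sum_pow_eq_one_sub_peq_pow (q : ℕ) {K P : ℕ} (p : ℝ) (hKP : K ≤ P) (m : ℕ) :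
    ∑ T, ringWeight K P T * (∑ U, ringWeight K P U * nonadjFactor q P p T U) ^ m =
      (1 - peq q K P p) ^ m := by
  have hone := sum_ringWeight hKP
  rw [← one_mul ((1 - peq q K P p) ^ m), ← hone, Finset.sum_mul, hone]
  refine Finset.sum_congr rfl fun T _ => ?_
  by_cases h : T.card = K
  · rw [sum_nonadjFactor q p hKP h]
  · simp [ringWeight, h]

lemma sum_sum_pow_le {q K P : ℕ} {p : ℝ} (hp1 : p ≤ 1) (hq : 1 ≤ q) (hK : 1 ≤ K)
    (hKP : K ≤ P) (m : ℕ) :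
    ∑ T, ∑ T', ringWeight K P T * ringWeight K P T' * (∑ U, ringWeight K P U *
        (nonadjFactor q P p T U * nonadjFactor q P p T' U)) ^ m ≤
      Real.exp (-(2 * m * peq q K P p) + m * p ^ 2 * (2 * ((K : ℝ) ^ 2 / P)) ^ (q + 1) +
        Real.exp (m * p ^ 2 * ((K : ℝ) ^ 2 / P) ^ q / K) * ((K : ℝ) ^ 2 / P)) := by
  set x := (K : ℝ) ^ 2 / P with hx
  set a := m * p ^ 2 * x ^ q / K with ha
  set c := Real.exp (-(2 * m * peq q K P p) + m * p ^ 2 * (2 * x) ^ (q + 1)) with hc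
  have ha0 : 0 ≤ a := by positivity
  have hnn : ∀ T U, 0 ≤ nonadjFactor q P p T U := fun T U => by
    rw [nonadjFactor]; split_ifs <;> linarith
  have hterm : ∀ T T', ringWeight K P T * ringWeight K P T' * (∑ U, ringWeight K P U *
        (nonadjFactor q P p T U * nonadjFactor q P p T' U)) ^ m ≤
      ringWeight K P T * (c * (ringWeight K P T' * Real.exp (a * (T ∩ T').card))) := by
    intro T T'
    by_cases hT : T.card = K
    swap; · simp [ringWeight, hT]
    by_cases hT' : T'.card = K
    swap; · simp [ringWeight, hT']
    have hpow : (∑ U, ringWeight K P U *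
        (nonadjFactor q P p T U * nonadjFactor q P p T' U)) ^ m ≤
        c * Real.exp (a * (T ∩ T').card) := by
      have h0 : 0 ≤ ∑ U, ringWeight K P U *
          (nonadjFactor q P p T U * nonadjFactor q P p T' U) :=
        Finset.sum_nonneg fun U _ => mul_nonneg (ringWeight_nonneg K P U)
          (mul_nonneg (hnn T U) (hnn T' U))
      have h1 : ∑ U, ringWeight K P U * (nonadjFactor q P p T U * nonadjFactor q P p T' U) ≤
          Real.exp (-(2 * peq q K P p) +
            p ^ 2 * (x ^ q / K * (T ∩ T').card + (2 * x) ^ (q + 1))) := by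
        rw [sum_nonadjFactor_mul q p hKP hT hT']
        refine le_trans ?_ (Real.add_one_le_exp _)
        have := mul_le_mul_of_nonneg_left (ringProb_share_both_le hq hK hKP hT hT')
          (sq_nonneg p)
        linarith
      refine (pow_le_pow_left₀ h0 h1 m).trans (le_of_eq ?_)
      rw [← Real.exp_nat_mul, hc, ← Real.exp_add, ha]
      congr 1; ring
    calc _ ≤ ringWeight K P T * ringWeight K P T' * (c * Real.exp (a * (T ∩ T').card)) :=
          mul_le_mul_of_nonneg_left hpow
            (mul_nonneg (ringWeight_nonneg K P T) (ringWeight_nonneg K P T'))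
      _ = _ := by ring
  calc _ ≤ ∑ T, ∑ T', ringWeight K P T *
        (c * (ringWeight K P T' * Real.exp (a * (T ∩ T').card))) :=
        Finset.sum_le_sum fun T _ => Finset.sum_le_sum fun T' _ => hterm T T'
    _ = ∑ T, ringWeight K P T *
        (c * ∑ T', ringWeight K P T' * Real.exp (a * (T ∩ T').card)) := by
        simp_rw [Finset.mul_sum]
    _ ≤ ∑ T, ringWeight K P T * (c * Real.exp (Real.exp a * x)) := by
        refine Finset.sum_le_sum fun T _ => ?_
        by_cases hT : T.card = K
        · exact mul_le_mul_of_nonneg_left (mul_le_mul_of_nonneg_left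
            (sum_exp_inter_card_le hKP hT ha0) (Real.exp_pos _).le) (ringWeight_nonneg K P T)
        · simp [ringWeight, hT]
    _ = c * Real.exp (Real.exp a * x) := by
        rw [← Finset.sum_mul, sum_ringWeight hKP, one_mul]
    _ = _ := by rw [hc, ← Real.exp_add]

/-- A non-asymptotic lower bound on the probability that some vertex is isolated. -/
lemma one_sub_prob_minDeg_eq_zero_le {q n K P : ℕ} {p : ℝ} (hp0 : 0 ≤ p) (hp1 : p ≤ 1)
    (hq : 1 ≤ q) (hK : 1 ≤ K) (hKP : K ≤ P) (hn : 2 ≤ n) (he0 : 0 ≤ peq q K P p)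
    (he : peq q K P p ≤ 1 / 2) :
    1 - prob n K P p {ω | minDeg q n P ω = 0} ≤
      Real.exp (n * peq q K P p + n * peq q K P p ^ 2 - Real.log n) +
        (Real.exp (2 * peq q K P p + 2 * (n * peq q K P p ^ 2) +
          n * p ^ 2 * (2 * ((K : ℝ) ^ 2 / P)) ^ (q + 1) +
          Real.exp (n * p ^ 2 * ((K : ℝ) ^ 2 / P) ^ q / K) * ((K : ℝ) ^ 2 / P)) - 1) := by
  set e := peq q K P p with hedef
  set x := (K : ℝ) ^ 2 / P with hx
  have hx0 : 0 ≤ x := by positivity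
  have ha : 0 < (1 - e) ^ (n - 1) := pow_pos (by linarith) _
  have key := one_sub_prob_minDeg_le q hp0 hp1 hKP hn ha
    (sum_pow_eq_one_sub_peq_pow q p hKP (n - 1)) (sum_sum_pow_le hp1 hq hK hKP (n - 2))
  refine key.trans ?_
  have hn1 : ((n - 1 : ℕ) : ℝ) = n - 1 := by rw [Nat.cast_sub (by lia)]; simp
  have hn2 : ((n - 2 : ℕ) : ℝ) = n - 2 := by rw [Nat.cast_sub hn]; simp
  have hnR : (2 : ℝ) ≤ n := by exact_mod_cast hn
  have hexp : Real.exp (-(e + e ^ 2)) ≤ 1 - e := by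
    rw [Real.exp_neg, inv_le_comm₀ (Real.exp_pos _) (by linarith)]
    refine le_trans ?_ (Real.quadratic_le_exp_of_nonneg (by positivity))
    rw [inv_le_iff_one_le_mul₀ (by linarith)]
    have h : 0 ≤ 1 - e - e ^ 2 - e ^ 3 := by nlinarith [mul_nonneg he0 he0]
    nlinarith [mul_nonneg (sq_nonneg e) h]
  have hlow : Real.exp (-((n - 1) * (e + e ^ 2))) ≤ (1 - e) ^ (n - 1) := by
    refine le_trans (le_of_eq ?_) (pow_le_pow_left₀ (Real.exp_pos _).le hexp (n - 1))
    rw [← Real.exp_nat_mul, hn1]; congr 1; ring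
  rw [add_sub_assoc]
  refine add_le_add ?_ (sub_le_sub_right ?_ 1)
  · rw [div_le_iff₀ (by positivity)]
    have h : Real.exp (n * e + n * e ^ 2 - Real.log n) * (n * Real.exp (-((n - 1) * (e + e ^ 2))))
        = Real.exp (e + e ^ 2) := by
      rw [Real.exp_sub, Real.exp_log (by linarith), div_mul_eq_mul_div,
        div_eq_iff (by positivity), mul_left_comm, ← Real.exp_add, mul_comm]
      congr 2; ring
    calc 1 ≤ Real.exp (e + e ^ 2) := Real.one_le_exp (by positivity)
      _ = _ := h.symm
      _ ≤ _ := by gcongr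
  · rw [div_le_iff₀ (by positivity)]
    calc _ ≤ Real.exp (-(2 * (n - 2) * e) + n * p ^ 2 * (2 * x) ^ (q + 1) +
          Real.exp (n * p ^ 2 * x ^ q / K) * x) := by
          rw [hn2]
          gcongr <;> linarith
      _ ≤ Real.exp (2 * e + 2 * (n * e ^ 2) + n * p ^ 2 * (2 * x) ^ (q + 1) +
          Real.exp (n * p ^ 2 * x ^ q / K) * x) * Real.exp (-((n - 1) * (e + e ^ 2))) ^ 2 := by
          rw [← Real.exp_nat_mul, ← Real.exp_add]
          refine Real.exp_le_exp.2 ?_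
          push_cast
          nlinarith [sq_nonneg e]
      _ ≤ _ := by gcongr

lemma tendsto_zero_of_pow_le {f g : ℕ → ℝ} {q : ℕ} (hq : q ≠ 0) (hf : ∀ᶠ n in atTop, 0 ≤ f n)
    (hfg : ∀ᶠ n in atTop, f n ^ q ≤ g n) (hg : Tendsto g atTop (nhds 0)) :
    Tendsto f atTop (nhds 0) := by
  have h0 : Tendsto (fun n => f n ^ q) atTop (nhds 0) :=
    squeeze_zero' (hf.mono fun n h => pow_nonneg h q) hfg hg
  have h1 := h0.rpow_const (p := ((q : ℝ)⁻¹)) (Or.inr (by positivity))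
  rw [Real.zero_rpow (by positivity)] at h1
  refine h1.congr' (hf.mono fun n h => ?_)
  exact Real.pow_rpow_inv_natCast h hq

/-- under the fine-grained scaling
`p_{e,q}(n) = (ln n + (k−1) ln ln n + b ln ln n + β_n)/n` with
`−1 < liminf β_n/ln ln n ≤ limsup β_n/ln ln n < 1` (i.e.,
`c₁ ln ln n ≤ β_n ≤ c₂ ln ln n` eventually, for constants `−1 < c₁ ≤ c₂ < 1`),
if `k + b ≤ 0` then `P[min degree of 𝔾_q(n,K_n,P_n,p_n) = 0] → 1`. -/
theorem min_degree_eq_zero_prob_one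
    (q : ℕ) (hq : 1 ≤ q) (k : ℕ) (hk : 1 ≤ k) (b : ℤ)
    (K P : ℕ → ℕ) (p : ℕ → ℝ) (β : ℕ → ℝ)
    (c₁ c₂ : ℝ) (hc₁ : -1 < c₁) (hc₁₂ : c₁ ≤ c₂) (hc₂ : c₂ < 1)
    (hK1 : ∀ n, 1 ≤ K n) (hKP : ∀ n, K n ≤ P n)
    (hp : ∀ n, p n ∈ Set.Ioc (0 : ℝ) 1)
    (hKinf : Tendsto (fun n => (K n : ℝ)) atTop atTop)
    (hKsqP : Tendsto (fun n => ((K n : ℝ)) ^ 2 / (P n : ℝ)) atTop (nhds 0))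
    (hpe : ∀ n : ℕ, peq q (K n) (P n) (p n)
      = (Real.log (n : ℝ) + ((k : ℝ) - 1) * Real.log (Real.log (n : ℝ))
          + (b : ℝ) * Real.log (Real.log (n : ℝ)) + β n) / (n : ℝ))
    (hβbound : ∀ᶠ (n : ℕ) in atTop,
      c₁ * Real.log (Real.log (n : ℝ)) ≤ β n ∧ β n ≤ c₂ * Real.log (Real.log (n : ℝ)))
    (hkb : (k : ℤ) + b ≤ 0) :
    Tendsto (fun n => prob n (K n) (P n) (p n) {ω | minDeg q n (P n) ω = 0})
      atTop (nhds 1) := by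
  have hlog : Tendsto (fun n : ℕ => Real.log n) atTop atTop :=
    Real.tendsto_log_atTop.comp tendsto_natCast_atTop_atTop
  have hloglog : Tendsto (fun n : ℕ => Real.log (Real.log n)) atTop atTop :=
    Real.tendsto_log_atTop.comp hlog
  have hlogpow : ∀ m : ℕ, Tendsto (fun n : ℕ => Real.log n ^ m / n) atTop (nhds 0) := fun m =>
    (Real.isLittleO_pow_log_id_atTop (n := m)).tendsto_div_nhds_zero.comp
      tendsto_natCast_atTop_atTop
  have hloghalf : Tendsto (fun n : ℕ => Real.log n ^ 2 * Real.exp (-(Real.log n / 2))) atTop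
      (nhds 0) := by
    have h := ((Real.tendsto_pow_mul_exp_neg_atTop_nhds_zero 2).comp
      (hlog.atTop_div_const (by norm_num : (0 : ℝ) < 2))).const_mul 4
    rw [mul_zero] at h
    refine h.congr fun n => ?_
    simp only [Function.comp_apply]
    ring
  obtain ⟨C, hC⟩ : ∃ C : ℝ, C = 2 * 4 ^ q * (q.factorial : ℝ) ^ 2 := ⟨_, rfl⟩
  have hC0 : 0 < C := by rw [hC]; positivity
  set x : ℕ → ℝ := fun n => (K n : ℝ) ^ 2 / P n with hx
  set e : ℕ → ℝ := fun n => peq q (K n) (P n) (p n) with he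
  have hx0 : ∀ n, 0 ≤ x n := fun n => by positivity
  have hne : ∀ᶠ n : ℕ in atTop,
      n * e n ≤ Real.log n - (1 - c₂) * Real.log (Real.log n) := by
    filter_upwards [hβbound, hloglog.eventually_ge_atTop 0, eventually_ge_atTop 1] with n hβ hll hn
    have hn0 : (n : ℝ) ≠ 0 := by positivity
    have hkb' : (k : ℝ) + b ≤ 0 := by exact_mod_cast hkb
    simp only [he, hpe n]
    rw [mul_div_cancel₀ _ hn0]
    nlinarith [mul_nonneg hll (neg_nonneg.2 hkb')]
  have hneL : ∀ᶠ n : ℕ in atTop, n * e n ≤ Real.log n := by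
    filter_upwards [hne, hloglog.eventually_ge_atTop 0] with n h hll
    nlinarith
  have hpx : ∀ᶠ n : ℕ in atTop, p n * x n ^ q ≤ C * e n := by
    filter_upwards [hKinf.eventually_ge_atTop ((2 * q : ℕ) : ℝ),
      hKsqP.eventually_le_const (by norm_num : (0 : ℝ) < 1 / 4)] with n hKn hxn
    have hP : (0 : ℝ) < P n := by exact_mod_cast (hK1 n).trans (hKP n)
    have h4 : 4 * K n ^ 2 ≤ P n := by
      rw [div_le_iff₀ hP] at hxn
      exact_mod_cast (by linarith : 4 * (K n : ℝ) ^ 2 ≤ P n)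
    have h := le_psq hq (by exact_mod_cast hKn) h4
    rw [← hC, div_le_iff₀ hC0] at h
    have := mul_le_mul_of_nonneg_left h (hp n).1.le
    simp only [he, peq]
    linarith
  have he0 : ∀ᶠ n : ℕ in atTop, 0 ≤ e n := by
    filter_upwards [hpx] with n h
    exact nonneg_of_mul_nonneg_right ((mul_nonneg (hp n).1.le (pow_nonneg (hx0 n) q)).trans h) hC0
  have hnpx : ∀ᶠ n : ℕ in atTop, n * (p n * x n ^ q) ≤ C * Real.log n := by
    filter_upwards [hpx, hneL] with n h1 h2
    calc n * (p n * x n ^ q) ≤ n * (C * e n) := by gcongr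
      _ = C * (n * e n) := by ring
      _ ≤ _ := by gcongr
  have hpx' : ∀ᶠ n : ℕ in atTop, p n * x n ^ q ≤ C * Real.log n / n := by
    filter_upwards [hnpx, eventually_ge_atTop 1] with n h hn
    rw [le_div_iff₀ (by exact_mod_cast hn)]
    linarith
  have heL : ∀ᶠ n : ℕ in atTop, e n ≤ Real.log n / n := by
    filter_upwards [hneL, eventually_ge_atTop 1] with n h hn
    rw [le_div_iff₀ (by exact_mod_cast hn)]
    linarith
  have hlim_e : Tendsto e atTop (nhds 0) :=
    squeeze_zero' he0 heL (by simpa using hlogpow 1)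
  have hlim_ne2 : Tendsto (fun n => n * e n ^ 2) atTop (nhds 0) := by
    refine squeeze_zero' (.of_forall fun n => by positivity) ?_ (hlogpow 2)
    filter_upwards [he0, hneL, heL, hlog.eventually_ge_atTop 0] with n h0 h1 h2 h3
    calc n * e n ^ 2 = (n * e n) * e n := by ring
      _ ≤ Real.log n * (Real.log n / n) := by gcongr
      _ = _ := by ring
  have hlim_first : Tendsto (fun n : ℕ => Real.exp (n * e n + n * e n ^ 2 - Real.log n)) atTop
      (nhds 0) := by
    have h : Tendsto (fun n : ℕ => n * e n ^ 2 + -((1 - c₂) * Real.log (Real.log n))) atTop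
        atBot :=
      hlim_ne2.add_atBot
        (tendsto_neg_atTop_atBot.comp (hloglog.const_mul_atTop (by linarith)))
    refine squeeze_zero' (.of_forall fun n => (Real.exp_pos _).le) ?_ (Real.tendsto_exp_atBot.comp h)
    filter_upwards [hne] with n h
    exact Real.exp_le_exp.2 (by linarith)
  have hlim_Lpx : Tendsto (fun n : ℕ => Real.log n * (p n * x n)) atTop (nhds 0) := by
    refine tendsto_zero_of_pow_le (by lia : q ≠ 0) ?_ ?_
      (by simpa using (hlogpow (q + 1)).const_mul C)
    · filter_upwards [hlog.eventually_ge_atTop 0] with n h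
      exact mul_nonneg h (mul_nonneg (hp n).1.le (hx0 n))
    · filter_upwards [hpx', hlog.eventually_ge_atTop 0] with n h hL
      have hpq : p n ^ q ≤ p n := pow_le_of_le_one (hp n).1.le (hp n).2 (by lia)
      calc (Real.log n * (p n * x n)) ^ q = Real.log n ^ q * (p n ^ q * x n ^ q) := by ring
        _ ≤ Real.log n ^ q * (p n * x n ^ q) := by
          have := hx0 n
          gcongr
        _ ≤ Real.log n ^ q * (C * Real.log n / n) := by gcongr
        _ = _ := by ring
  have hlim_third : Tendsto (fun n : ℕ => n * p n ^ 2 * (2 * x n) ^ (q + 1)) atTop (nhds 0) := by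
    refine squeeze_zero' (.of_forall fun n => ?_) ?_
      (by simpa using hlim_Lpx.const_mul (2 ^ (q + 1) * C))
    · have := hx0 n
      positivity
    · filter_upwards [hnpx] with n h
      have hpx0 : 0 ≤ p n * x n := mul_nonneg (hp n).1.le (hx0 n)
      calc n * p n ^ 2 * (2 * x n) ^ (q + 1)
          = 2 ^ (q + 1) * (n * (p n * x n ^ q) * (p n * x n)) := by ring
        _ ≤ 2 ^ (q + 1) * (C * Real.log n * (p n * x n)) := by gcongr
        _ = _ := by ring
  have hlim_fourth : Tendsto (fun n : ℕ =>
      Real.exp (n * p n ^ 2 * x n ^ q / K n) * x n) atTop (nhds 0) := by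
    refine tendsto_zero_of_pow_le (by lia : q ≠ 0) (.of_forall fun n => ?_) ?_
      (g := fun n : ℕ => (Real.exp C * x n) ^ q +
        C * (Real.log n ^ 2 * Real.exp (-(Real.log n / 2)))) ?_
    · exact mul_nonneg (Real.exp_pos _).le (hx0 n)
    · filter_upwards [hnpx, hpx', hlog.eventually_ge_atTop 0, eventually_ge_atTop 1,
        hKinf.eventually_ge_atTop (2 * q * C)] with n h h' hL hn hKn
      have hK0 : (1 : ℝ) ≤ K n := by exact_mod_cast hK1 n
      have hexp : n * p n ^ 2 * x n ^ q / K n ≤ C * (p n * Real.log n) / K n := by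
        refine div_le_div_of_nonneg_right ?_ (by linarith)
        calc n * p n ^ 2 * x n ^ q = n * (p n * x n ^ q) * p n := by ring
          _ ≤ C * Real.log n * p n := by
            have := (hp n).1.le
            gcongr
          _ = _ := by ring
      have hxn := hx0 n
      rcases le_total (p n * Real.log n) 1 with hpl | hpl
      · refine le_add_of_le_of_nonneg ?_ (by positivity)
        gcongr
        refine hexp.trans ?_
        rw [div_le_iff₀ (by linarith)]
        nlinarith
      · refine le_add_of_nonneg_of_le (by positivity) ?_
        have h1 : q * (C * (p n * Real.log n) / K n) ≤ Real.log n / 2 := by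
          rw [← mul_div_assoc, div_le_iff₀ (by linarith)]
          have hpL : p n * Real.log n ≤ Real.log n := mul_le_of_le_one_left hL (hp n).2
          calc q * (C * (p n * Real.log n)) ≤ q * (C * Real.log n) := by gcongr
            _ = Real.log n / 2 * (2 * q * C) := by ring
            _ ≤ _ := by gcongr
        have h2 : x n ^ q ≤ C * Real.log n ^ 2 / n := by
          calc x n ^ q ≤ (p n * Real.log n) * x n ^ q :=
                le_mul_of_one_le_left (by positivity) hpl
            _ = Real.log n * (p n * x n ^ q) := by ring
            _ ≤ Real.log n * (C * Real.log n / n) := by gcongr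
            _ = _ := by ring
        have h3 : Real.exp (Real.log n / 2) / n = Real.exp (-(Real.log n / 2)) := by
          have hn0 : (0 : ℝ) < n := by exact_mod_cast hn
          nth_rewrite 2 [← Real.exp_log hn0]
          rw [← Real.exp_sub]
          congr 1
          ring
        calc (Real.exp (n * p n ^ 2 * x n ^ q / K n) * x n) ^ q
            = Real.exp (q * (n * p n ^ 2 * x n ^ q / K n)) * x n ^ q := by
              rw [mul_pow, ← Real.exp_nat_mul]
          _ ≤ Real.exp (Real.log n / 2) * (C * Real.log n ^ 2 / n) := by
              gcongr
              exact (mul_le_mul_of_nonneg_left hexp (Nat.cast_nonneg q)).trans h1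
          _ = C * (Real.log n ^ 2 * (Real.exp (Real.log n / 2) / n)) := by ring
          _ = _ := by rw [h3]
    · have h := ((hKsqP.const_mul (Real.exp C)).pow q).add (hloghalf.const_mul C)
      simpa [zero_pow (by lia : q ≠ 0)] using h
  have hlim : Tendsto (fun n : ℕ => Real.exp (n * e n + n * e n ^ 2 - Real.log n) +
      (Real.exp (2 * e n + 2 * (n * e n ^ 2) + n * p n ^ 2 * (2 * x n) ^ (q + 1) +
        Real.exp (n * p n ^ 2 * x n ^ q / K n) * x n) - 1)) atTop (nhds 0) := by
    have h := ((((hlim_e.const_mul 2).add (hlim_ne2.const_mul 2)).add hlim_third).add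
      hlim_fourth).rexp
    simpa using hlim_first.add (h.sub_const 1)
  refine tendsto_of_tendsto_of_tendsto_of_le_of_le'
    (by simpa using hlim.const_sub 1) tendsto_const_nhds ?_
    (.of_forall fun n => prob_le_one (hp n).1.le (hp n).2 (hKP n) _)
  filter_upwards [he0, hlim_e.eventually_le_const (by norm_num : (0 : ℝ) < 1 / 2),
    eventually_ge_atTop 2] with n h0 h1 hn
  rw [sub_le_comm]
  exact one_sub_prob_minDeg_eq_zero_le (hp n).1.le (hp n).2 hq (hK1 n) (hKP n) hn h0 h1
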